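/- Fix σ > 0 and set Σ = σ² I_{d1}, so L(U,V) = ‖U Vᵀ − Z‖_F² + σ²‖U‖_F² + β(η_dec²/η_enc²)‖V‖_F², and let ζ_max denote the largest singular value of Z. Then the Hessian quadratic form of L at the origin, Q(ΔU, ΔV) = σ²‖ΔU‖_F² − 2 Tr(Z ΔV ΔUᵀ) + β(η_dec²/η_enc²)‖ΔV‖_F², is positive semidefinite if and only if (U,V) = (0,0) is a global minimizer of L; both are equivalent to ζ_max² ≤ σ² β η_dec²/η_enc². In particular, the origin is never a non-global local minimum: it is either a saddle point or the global minimum. -/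

import Mathlib

open Matrix BigOperators

noncomputable def frobSq {m n : ℕ} (M : Matrix (Fin m) (Fin n) ℝ) : ℝ :=
  ∑ i, ∑ j, (M i j) ^ 2

lemma frobSq_eq_trace {m n : ℕ} (M : Matrix (Fin m) (Fin n) ℝ) :
    frobSq M = Matrix.trace (Mᵀ * M) := by
  unfold frobSq
  rw [Finset.sum_comm]
  simp [Matrix.trace, Matrix.mul_apply, pow_two]

lemma frobSq_nonneg {m n : ℕ} (M : Matrix (Fin m) (Fin n) ℝ) : 0 ≤ frobSq M := by
  unfold frobSq; positivity

lemma frobSq_smul {m n : ℕ} (t : ℝ) (M : Matrix (Fin m) (Fin n) ℝ) :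
    frobSq (t • M) = t ^ 2 * frobSq M := by
  simp [frobSq, Finset.mul_sum, mul_pow]

lemma frobSq_orth {m n : ℕ} (F : Matrix (Fin m) (Fin m) ℝ) (hF : Fᵀ * F = 1)
    (M : Matrix (Fin m) (Fin n) ℝ) : frobSq (F * M) = frobSq M := by
  rw [frobSq_eq_trace, frobSq_eq_trace, Matrix.transpose_mul, Matrix.mul_assoc,
    ← Matrix.mul_assoc Fᵀ, hF, Matrix.one_mul]

lemma frobSq_sub {m n : ℕ} (A B : Matrix (Fin m) (Fin n) ℝ) :
    frobSq (A - B) = frobSq A - 2 * Matrix.trace (Bᵀ * A) + frobSq B := by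
  have h : Matrix.trace (Aᵀ * B) = Matrix.trace (Bᵀ * A) := by
    rw [← Matrix.trace_transpose, Matrix.transpose_mul, Matrix.transpose_transpose]
  simp only [frobSq_eq_trace, Matrix.transpose_sub, Matrix.sub_mul, Matrix.mul_sub,
    Matrix.trace_sub, h]
  ring

lemma sum_diag_le {p q : ℕ} (f : Fin p → ℝ) (hf : ∀ i, 0 ≤ f i) :
    ∑ i : Fin p, ∑ j : Fin q, (if (i : ℕ) = (j : ℕ) then f i else 0) ≤ ∑ i, f i := by
  apply Finset.sum_le_sum
  intro i _
  by_cases h : (i : ℕ) < q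
  · have : ∀ j : Fin q, (if (i : ℕ) = (j : ℕ) then f i else 0)
        = if (⟨i, h⟩ : Fin q) = j then f i else 0 := by
      intro j; simp [Fin.ext_iff]
    simp [this]
  · have : ∀ j : Fin q, (if (i : ℕ) = (j : ℕ) then f i else 0) = 0 := by
      intro j
      have := j.2
      rw [if_neg]; omega
    simp [this, hf i]

lemma diag_bound {p q : ℕ} (ζ : ℕ → ℝ) (a c : ℝ) (ha : 0 ≤ a) (hc : 0 ≤ c)
    (h : ∀ i, ∀ u v : ℝ, 2 * (ζ i * v * u) ≤ a * u ^ 2 + c * v ^ 2)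
    (u : Fin p → ℝ) (v : Fin q → ℝ) :
    2 * ∑ i : Fin p, ∑ j : Fin q, (if (i : ℕ) = (j : ℕ) then ζ i else 0) * v j * u i
      ≤ a * ∑ i, u i ^ 2 + c * ∑ j, v j ^ 2 := by
  have h1 := sum_diag_le (q := q) (fun i : Fin p => a * u i ^ 2) (fun i => by positivity)
  have h2 := sum_diag_le (q := p) (fun j : Fin q => c * v j ^ 2) (fun i => by positivity)
  rw [Finset.sum_comm] at h2
  rw [Finset.mul_sum, Finset.mul_sum, Finset.mul_sum]
  refine le_trans ?_ (add_le_add h1 h2)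
  rw [← Finset.sum_add_distrib]
  apply Finset.sum_le_sum
  intro i _
  rw [← Finset.sum_add_distrib, Finset.mul_sum]
  apply Finset.sum_le_sum
  intro j _
  by_cases hij : (i : ℕ) = j
  · rw [if_pos hij, if_pos hij, if_pos hij.symm]; exact h _ _ _
  · rw [if_neg hij, if_neg hij, if_neg (Ne.symm hij)]; simp

lemma trace_diag_bound {p q r : ℕ} (ζ : ℕ → ℝ) (a c : ℝ) (ha : 0 ≤ a) (hc : 0 ≤ c)
    (h : ∀ i, ∀ u v : ℝ, 2 * (ζ i * v * u) ≤ a * u ^ 2 + c * v ^ 2)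
    (U : Matrix (Fin p) (Fin r) ℝ) (V : Matrix (Fin q) (Fin r) ℝ) :
    2 * Matrix.trace ((Matrix.of fun (i : Fin p) (j : Fin q) =>
        if (i : ℕ) = (j : ℕ) then ζ i else 0) * V * Uᵀ)
      ≤ a * frobSq U + c * frobSq V := by
  have e : Matrix.trace ((Matrix.of fun (i : Fin p) (j : Fin q) =>
        if (i : ℕ) = (j : ℕ) then ζ i else 0) * V * Uᵀ)
      = ∑ k, ∑ i : Fin p, ∑ j : Fin q, (if (i : ℕ) = (j : ℕ) then ζ i else 0) * V j k * U i k := by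
    rw [Finset.sum_comm]
    simp only [Matrix.trace, Matrix.diag, Matrix.mul_apply, Matrix.transpose_apply,
      Matrix.of_apply, Finset.sum_mul]
  have eU : frobSq U = ∑ k, ∑ i, U i k ^ 2 := Finset.sum_comm
  have eV : frobSq V = ∑ k, ∑ i, V i k ^ 2 := Finset.sum_comm
  rw [e, eU, eV, Finset.mul_sum, Finset.mul_sum, Finset.mul_sum, ← Finset.sum_add_distrib]
  exact Finset.sum_le_sum fun k _ =>
    diag_bound ζ a c ha hc h (fun i => U i k) (fun j => V j k)

lemma frobSq_single {m n : ℕ} (i : Fin m) (j : Fin n) (x : ℝ) :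
    frobSq (Matrix.single i j x) = x ^ 2 := by
  rw [frobSq_eq_trace]
  simp [Matrix.transpose_single, pow_two]

/-- the Hessian of the reduced VAE objective at the origin is
positive semidefinite iff the origin is a global minimizer; both are equivalent
to `ζ_max² ≤ σ² β η_dec²/η_enc²` (so the origin is never a non-global local
minimum). -/
theorem origin_psd_iff_global_min
    (d0 d1 d2 : ℕ) (hd0 : 1 ≤ d0) (hd1 : 1 ≤ d1) (hd2 : 1 ≤ d2)
    (β ηenc ηdec σ : ℝ) (hβ : 0 < β) (henc : 0 < ηenc) (hdec : 0 < ηdec)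
    (hσ : 0 < σ)
    (ζ : ℕ → ℝ) (hζmono : ∀ i j, i ≤ j → ζ j ≤ ζ i) (hζnn : ∀ i, 0 ≤ ζ i)
    (hζzero : ∀ i, min d0 d2 ≤ i → ζ i = 0)
    (F : Matrix (Fin d2) (Fin d2) ℝ) (G : Matrix (Fin d0) (Fin d0) ℝ)
    (hF : Fᵀ * F = 1) (hF' : F * Fᵀ = 1) (hG : Gᵀ * G = 1) (hG' : G * Gᵀ = 1)
    (Z : Matrix (Fin d2) (Fin d0) ℝ)
    (hZ : Z = F * (Matrix.of fun (i : Fin d2) (j : Fin d0) =>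
        if (i : ℕ) = (j : ℕ) then ζ i else 0) * Gᵀ)
    (L : Matrix (Fin d2) (Fin d1) ℝ → Matrix (Fin d0) (Fin d1) ℝ → ℝ)
    (hL : ∀ U V, L U V = frobSq (U * Vᵀ - Z) + σ ^ 2 * frobSq U
        + β * (ηdec ^ 2 / ηenc ^ 2) * frobSq V)
    (Q : Matrix (Fin d2) (Fin d1) ℝ → Matrix (Fin d0) (Fin d1) ℝ → ℝ)
    (hQ : ∀ ΔU ΔV, Q ΔU ΔV = σ ^ 2 * frobSq ΔU
        - 2 * Matrix.trace (Z * ΔV * ΔUᵀ)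
        + β * (ηdec ^ 2 / ηenc ^ 2) * frobSq ΔV) :
    ((∀ ΔU ΔV, 0 ≤ Q ΔU ΔV) ↔ (∀ U V, L 0 0 ≤ L U V))
    ∧ ((∀ U V, L 0 0 ≤ L U V) ↔ ζ 0 ^ 2 ≤ σ ^ 2 * (β * ηdec ^ 2 / ηenc ^ 2)) := by
  have hc : 0 < β * (ηdec ^ 2 / ηenc ^ 2) := by positivity
  have hce : β * ηdec ^ 2 / ηenc ^ 2 = β * (ηdec ^ 2 / ηenc ^ 2) := by ring
  rw [hce]
  generalize β * (ηdec ^ 2 / ηenc ^ 2) = c at *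
  have hs : 0 < σ ^ 2 := by positivity
  generalize σ ^ 2 = a at *
  have hLQ : ∀ U V, L U V = L 0 0 + frobSq (U * Vᵀ) + Q U V := by
    intro U V
    have ht : Matrix.trace (Zᵀ * (U * Vᵀ)) = Matrix.trace (Z * V * Uᵀ) := by
      rw [← Matrix.trace_transpose, Matrix.transpose_mul, Matrix.transpose_mul,
        Matrix.transpose_transpose, Matrix.transpose_transpose, Matrix.trace_mul_comm,
        Matrix.mul_assoc]
    have h0 : ∀ m n : ℕ, frobSq (0 : Matrix (Fin m) (Fin n) ℝ) = 0 := by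
      intro m n; simp [frobSq]
    rw [hL, hL, hQ, frobSq_sub, frobSq_sub, ht]
    simp [h0]
    ring
  have h1 : (∀ ΔU ΔV, 0 ≤ Q ΔU ΔV) ↔ (∀ U V, L 0 0 ≤ L U V) := by
    constructor
    · intro h U V
      rw [hLQ U V]
      linarith [h U V, frobSq_nonneg (U * Vᵀ)]
    · intro h U V
      by_contra hneg
      push Not at hneg
      have key : ∀ t : ℝ, 0 ≤ t ^ 4 * frobSq (U * Vᵀ) + t ^ 2 * Q U V := by
        intro t
        have := h (t • U) (t • V)
        rw [hLQ (t • U) (t • V)] at this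
        have e1 : frobSq ((t • U) * (t • V)ᵀ) = t ^ 4 * frobSq (U * Vᵀ) := by
          rw [Matrix.transpose_smul, Matrix.smul_mul, Matrix.mul_smul, frobSq_smul, frobSq_smul]
          ring
        have e2 : Q (t • U) (t • V) = t ^ 2 * Q U V := by
          rw [hQ, hQ, frobSq_smul, frobSq_smul, Matrix.transpose_smul, Matrix.mul_smul,
            Matrix.mul_smul, Matrix.smul_mul, Matrix.trace_smul, Matrix.trace_smul]
          simp only [smul_eq_mul]
          ring
        rw [e1, e2] at this
        linarith
      have hA := frobSq_nonneg (U * Vᵀ)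
      generalize frobSq (U * Vᵀ) = A at *
      generalize Q U V = q at *
      have hpos : 0 < -q / (2 * (A + 1)) := div_pos (by linarith) (by linarith)
      have hk := key (Real.sqrt (-q / (2 * (A + 1))))
      have e4 : ∀ x : ℝ, x ^ 4 = (x ^ 2) ^ 2 := fun x => by ring
      rw [e4, Real.sq_sqrt hpos.le] at hk
      have hx : -q / (2 * (A + 1)) * (2 * (A + 1)) = -q := by field_simp
      generalize -q / (2 * (A + 1)) = x at *
      have : 0 ≤ x * (x * A + q) := by linarith
      have h3 := nonneg_of_mul_nonneg_right this hpos
      nlinarith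
  refine ⟨h1, h1.symm.trans ?_⟩
  have hQ' : ∀ (U : Matrix (Fin d2) (Fin d1) ℝ) (V : Matrix (Fin d0) (Fin d1) ℝ), Q (F * U) (G * V) = a * frobSq U - 2 * Matrix.trace
      ((Matrix.of fun (i : Fin d2) (j : Fin d0) =>
        if (i : ℕ) = (j : ℕ) then ζ i else 0) * V * Uᵀ) + c * frobSq V := by
    intro U V
    rw [hQ, frobSq_orth F hF, frobSq_orth G hG, hZ]
    generalize (Matrix.of fun (i : Fin d2) (j : Fin d0) =>
        if (i : ℕ) = (j : ℕ) then ζ i else 0) = D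
    have : F * D * Gᵀ * (G * V) * (F * U)ᵀ = F * (D * V * Uᵀ * Fᵀ) := by
      rw [Matrix.mul_assoc (F * D), ← Matrix.mul_assoc Gᵀ, hG, Matrix.one_mul,
        Matrix.transpose_mul]
      simp only [Matrix.mul_assoc]
    rw [this, Matrix.trace_mul_comm, Matrix.mul_assoc, hF, Matrix.mul_one]
  constructor
  · intro h
    obtain ⟨i2, hi2⟩ : ∃ i : Fin d2, (i : ℕ) = 0 := ⟨⟨0, hd2⟩, rfl⟩
    obtain ⟨i1, hi1⟩ : ∃ i : Fin d1, (i : ℕ) = 0 := ⟨⟨0, hd1⟩, rfl⟩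
    obtain ⟨i0, hi0⟩ : ∃ i : Fin d0, (i : ℕ) = 0 := ⟨⟨0, hd0⟩, rfl⟩
    have hh := h (F * Matrix.single i2 i1 (ζ 0)) (G * Matrix.single i0 i1 a)
    rw [hQ', frobSq_single, frobSq_single, Matrix.mul_assoc, Matrix.transpose_single,
      Matrix.single_mul_single_same, Matrix.trace_mul_single] at hh
    simp [hi0, hi2] at hh
    have : 0 ≤ a * (a * c - ζ 0 ^ 2) := by linarith
    have := nonneg_of_mul_nonneg_right this hs
    linarith
  · intro h U V
    have hU : F * (Fᵀ * U) = U := by rw [← Matrix.mul_assoc, hF', Matrix.one_mul]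
    have hV : G * (Gᵀ * V) = V := by rw [← Matrix.mul_assoc, hG', Matrix.one_mul]
    rw [← hU, ← hV, hQ']
    have := trace_diag_bound ζ a c hs.le hc.le (fun i u v => by
      have hi : ζ i ^ 2 ≤ a * c :=
        le_trans (pow_le_pow_left₀ (hζnn i) (hζmono 0 i (Nat.zero_le i)) 2) h
      have : 0 ≤ a * (a * u ^ 2 + c * v ^ 2 - 2 * (ζ i * v * u)) := by
        nlinarith [sq_nonneg (a * u - ζ i * v), mul_nonneg (sub_nonneg.2 hi) (sq_nonneg v)]
      have := nonneg_of_mul_nonneg_right this hs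
      linarith) (Fᵀ * U) (Gᵀ * V)
    linarith
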